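/- Let S be a system with parts P and Q. The composite modality ◇^Q_P ∘ ◇^P_Q on constraints of P is the identity (i.e. for every constraint φ : B_P → Prop and every p : B_P, (◇^Q_P (◇^P_Q φ)) p ↔ φ p) if and only if P is a part of Q, i.e. there exists f : B_Q → B_P with f ∘ r_Q = r_P. -/

import Mathlib

/-- Allowance: `(◇^P_Q φ) q := ∃ s, r_Q s = q ∧ φ (r_P s)`. -/
def allows {BS BP BQ : Type*} (rP : BS → BP) (rQ : BS → BQ)
    (φ : BP → Prop) : BQ → Prop :=
  fun q => ∃ s : BS, rQ s = q ∧ φ (rP s)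

/-- the composite modality `◇^Q_P ∘ ◇^P_Q` on constraints of `P`
is the identity iff `P` is a part of `Q`. -/
theorem allows_allows_identity_iff_part {BS BP BQ : Type*}
    (rP : BS → BP) (rQ : BS → BQ)
    (hP : Function.Surjective rP) (hQ : Function.Surjective rQ) :
    (∀ (φ : BP → Prop) (p : BP), allows rQ rP (allows rP rQ φ) p ↔ φ p) ↔
      (∃ f : BQ → BP, f ∘ rQ = rP) := by
  constructor
  · intro h
    refine ⟨rP ∘ Function.surjInv hQ, funext fun s => ?_⟩
    exact (h (fun p => p = rP (Function.surjInv hQ (rQ s))) (rP s)).1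
      ⟨s, rfl, Function.surjInv hQ (rQ s), Function.surjInv_eq hQ (rQ s), rfl⟩ |>.symm
  · rintro ⟨f, rfl⟩ φ p
    constructor
    · rintro ⟨s, rfl, t, ht, hφ⟩
      simpa [ht] using hφ
    · intro hφ
      obtain ⟨s, rfl⟩ := hP p
      exact ⟨s, rfl, s, rfl, hφ⟩
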